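/- If all complex eigenvalues of the real p×p matrix A have positive real part, then for any real p×1 matrix B and real 1×p matrix C the Sylvester equation AP + PA = BC has exactly one real p×p solution P, namely P = ∫₀^∞ e^{−As} B C e^{−As} ds. -/

import Mathlib

open Matrix MeasureTheory Filter

noncomputable def mexp {p : ℕ} (M : Matrix (Fin p) (Fin p) ℝ) : Matrix (Fin p) (Fin p) ℝ :=
  ∑' k : ℕ, (k.factorial : ℝ)⁻¹ • M ^ k

def EigPos {p : ℕ} (A : Matrix (Fin p) (Fin p) ℝ) : Prop :=
  ∀ μ ∈ spectrum ℂ (A.map Complex.ofReal), 0 < μ.re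

def Observable {p : ℕ} (A : Matrix (Fin p) (Fin p) ℝ) (C : Matrix (Fin 1) (Fin p) ℝ) : Prop :=
  ∀ v : Fin p → ℝ, (∀ r : ℕ, (C * A ^ r) *ᵥ v = 0) → v = 0

def Controllable {p : ℕ} (A : Matrix (Fin p) (Fin p) ℝ) (B : Matrix (Fin p) (Fin 1) ℝ) : Prop :=
  ∀ v : Fin p → ℝ, (∀ r : ℕ, (Bᵀ * Aᵀ ^ r) *ᵥ v = 0) → v = 0

noncomputable def Qmat {p : ℕ} (A : Matrix (Fin p) (Fin p) ℝ) (C : Matrix (Fin 1) (Fin p) ℝ) :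
    Matrix (Fin p) (Fin p) ℝ :=
  Matrix.of fun i j =>
    ∫ s in Set.Ioi (0 : ℝ), (mexp (-(s • Aᵀ)) * (Cᵀ * C) * mexp (-(s • A))) i j

noncomputable def Nmat {p : ℕ} (A : Matrix (Fin p) (Fin p) ℝ) (B : Matrix (Fin p) (Fin 1) ℝ) :
    Matrix (Fin p) (Fin p) ℝ :=
  Matrix.of fun i j =>
    ∫ s in Set.Ioi (0 : ℝ), (mexp (-(s • A)) * (B * Bᵀ) * mexp (-(s • Aᵀ))) i j

noncomputable def Pmat {p : ℕ} (A : Matrix (Fin p) (Fin p) ℝ) (B : Matrix (Fin p) (Fin 1) ℝ)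
    (C : Matrix (Fin 1) (Fin p) ℝ) : Matrix (Fin p) (Fin p) ℝ :=
  Matrix.of fun i j =>
    ∫ s in Set.Ioi (0 : ℝ), (mexp (-(s • A)) * (B * C) * mexp (-(s • A))) i j

noncomputable def Fmat {p : ℕ} (A : Matrix (Fin p) (Fin p) ℝ) (B : Matrix (Fin p) (Fin 1) ℝ)
    (C : Matrix (Fin 1) (Fin p) ℝ) (x t : ℝ) : Matrix (Fin p) (Fin p) ℝ :=
  mexp ((2 * x) • Aᵀ - (8 * t) • Aᵀ ^ 3) +
    Qmat A C * mexp (-((2 * x) • A) + (8 * t) • A ^ 3) * Nmat A B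

noncomputable def Emat {p : ℕ} (A : Matrix (Fin p) (Fin p) ℝ) (B : Matrix (Fin p) (Fin 1) ℝ)
    (C : Matrix (Fin 1) (Fin p) ℝ) (x t : ℝ) : Matrix (Fin p) (Fin p) ℝ :=
  mexp ((2 * x) • A - (8 * t) • A ^ 3) +
    Pmat A B C * mexp (-((2 * x) • A) + (8 * t) • A ^ 3) * Pmat A B C

noncomputable def uFun {p : ℕ} (A : Matrix (Fin p) (Fin p) ℝ) (B : Matrix (Fin p) (Fin 1) ℝ)
    (C : Matrix (Fin 1) (Fin p) ℝ) (x t : ℝ) : ℝ :=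
  -2 * ((Bᵀ * (Fmat A B C x t)⁻¹ * Cᵀ : Matrix (Fin 1) (Fin 1) ℝ) 0 0)

noncomputable def vFun {p : ℕ} (A : Matrix (Fin p) (Fin p) ℝ) (B : Matrix (Fin p) (Fin 1) ℝ)
    (C : Matrix (Fin 1) (Fin p) ℝ) (x t : ℝ) : ℝ :=
  -2 * ((C * (Emat A B C x t)⁻¹ * B : Matrix (Fin 1) (Fin 1) ℝ) 0 0)

noncomputable def calQ {p : ℕ} (A : Matrix (Fin p) (Fin p) ℝ) (C : Matrix (Fin 1) (Fin p) ℝ)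
    (x t : ℝ) : Matrix (Fin p) (Fin p) ℝ :=
  mexp (-(x • Aᵀ)) * mexp ((8 * t) • Aᵀ ^ 3) * Qmat A C * mexp (-(x • A)) * mexp ((8 * t) • A ^ 3)

noncomputable def calN {p : ℕ} (A : Matrix (Fin p) (Fin p) ℝ) (B : Matrix (Fin p) (Fin 1) ℝ)
    (x : ℝ) : Matrix (Fin p) (Fin p) ℝ :=
  mexp (-(x • A)) * Nmat A B * mexp (-(x • Aᵀ))

noncomputable def Gam {p : ℕ} (A : Matrix (Fin p) (Fin p) ℝ) (B : Matrix (Fin p) (Fin 1) ℝ)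
    (C : Matrix (Fin 1) (Fin p) ℝ) (x t : ℝ) : Matrix (Fin p) (Fin p) ℝ :=
  1 + calQ A C x t * calN A B x

noncomputable def Om {p : ℕ} (A : Matrix (Fin p) (Fin p) ℝ) (B : Matrix (Fin p) (Fin 1) ℝ)
    (C : Matrix (Fin 1) (Fin p) ℝ) (w t : ℝ) : ℝ :=
  ((C * mexp (-(w • A)) * mexp ((8 * t) • A ^ 3) * B : Matrix (Fin 1) (Fin 1) ℝ) 0 0)

noncomputable def Kker {p : ℕ} (A : Matrix (Fin p) (Fin p) ℝ) (B : Matrix (Fin p) (Fin 1) ℝ)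
    (C : Matrix (Fin 1) (Fin p) ℝ) (x y t : ℝ) : ℝ :=
  ((Bᵀ * (Fmat A B C x t)⁻¹ * mexp (-((y - x) • Aᵀ)) * Cᵀ : Matrix (Fin 1) (Fin 1) ℝ) 0 0)

open scoped Matrix.Norms.Operator Topology
open Asymptotics

lemma mexp_eq {p : ℕ} (M : Matrix (Fin p) (Fin p) ℝ) : mexp M = NormedSpace.exp M := by
  rw [NormedSpace.exp_eq_tsum ℝ]; rfl

lemma exp_nil_vec {p : ℕ} (N : Matrix (Fin p) (Fin p) ℂ) (v : Fin p → ℂ) (k : ℕ)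
    (h : (N ^ k) *ᵥ v = 0) (s : ℂ) :
    NormedSpace.exp (s • N) *ᵥ v =
      ∑ j ∈ Finset.range k, ((j.factorial : ℂ)⁻¹ * s ^ j) • ((N ^ j) *ᵥ v) := by
  have h1 := NormedSpace.exp_series_hasSum_exp' (𝕂 := ℂ) (s • N)
  let L : Matrix (Fin p) (Fin p) ℂ →ₗ[ℂ] (Fin p → ℂ) :=
    { toFun := fun X => X *ᵥ v
      map_add' := fun X Y => Matrix.add_mulVec X Y v
      map_smul' := fun c X => Matrix.smul_mulVec c X v }
  have hL : Continuous L := L.continuous_of_finiteDimensional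
  have h2 := h1.mapL ⟨L, hL⟩
  have h3 : ∀ j : ℕ, L ((j.factorial : ℂ)⁻¹ • (s • N) ^ j) =
      ((j.factorial : ℂ)⁻¹ * s ^ j) • ((N ^ j) *ᵥ v) := by
    intro j
    rw [map_smul, smul_pow, map_smul, smul_smul]; rfl
  have h4 : HasSum (fun j : ℕ => ((j.factorial : ℂ)⁻¹ * s ^ j) • ((N ^ j) *ᵥ v))
      (NormedSpace.exp (s • N) *ᵥ v) := by
    rw [← funext h3]
    exact h2
  refine h4.unique (hasSum_sum_of_ne_finset_zero ?_)
  intro j hj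
  have hj' : k ≤ j := by simpa using hj
  obtain ⟨m, rfl⟩ := Nat.exists_eq_add_of_le hj'
  rw [add_comm, pow_add N, ← Matrix.mulVec_mulVec, h]; simp

lemma exp_shift {p : ℕ} (M : Matrix (Fin p) (Fin p) ℂ) (μ s : ℂ) :
    NormedSpace.exp (s • M) = Complex.exp (s * μ) • NormedSpace.exp (s • (M - μ • 1)) := by
  have : s • M = algebraMap ℂ (Matrix (Fin p) (Fin p) ℂ) (s * μ) + s • (M - μ • 1) := by
    rw [Algebra.algebraMap_eq_smul_one, smul_sub, smul_smul]; abel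
  have h2 : NormedSpace.exp (algebraMap ℂ (Matrix (Fin p) (Fin p) ℂ) (s * μ)) =
      algebraMap ℂ (Matrix (Fin p) (Fin p) ℂ) (Complex.exp (s * μ)) := by
    rw [Complex.exp_eq_exp_ℂ]
    exact (NormedSpace.map_exp (algebraMap ℂ (Matrix (Fin p) (Fin p) ℂ))
      (continuous_algebraMap _ _) _).symm
  have h3 := Matrix.exp_add_of_commute (algebraMap ℂ (Matrix (Fin p) (Fin p) ℂ) (s * μ))
    (s • (M - μ • 1)) (Algebra.commute_algebraMap_left _ _)
  rw [this]
  refine h3.trans ?_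
  refine (congrArg (· * NormedSpace.exp (s • (M - μ • 1))) h2).trans ?_
  simp only [Algebra.algebraMap_eq_smul_one, smul_mul_assoc, one_mul]

lemma exp_mono {c d : ℝ} (h : c ≤ d) :
    (fun s : ℝ => Real.exp (-d * s)) =O[atTop] fun s : ℝ => Real.exp (-c * s) := by
  refine IsBigO.of_bound 1 ?_
  filter_upwards [eventually_ge_atTop 0] with s hs
  simp only [Real.norm_eq_abs, Real.abs_exp, one_mul]
  apply Real.exp_le_exp.2
  nlinarith

def decaySub {p : ℕ} (M : Matrix (Fin p) (Fin p) ℂ) : Submodule ℂ (Fin p → ℂ) where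
  carrier := {v | ∃ c : ℝ, 0 < c ∧ (fun s : ℝ => NormedSpace.exp ((-s : ℂ) • M) *ᵥ v)
    =O[atTop] fun s : ℝ => Real.exp (-c * s)}
  add_mem' := by
    rintro v w ⟨c, hc, h⟩ ⟨d, hd, h'⟩
    refine ⟨min c d, lt_min hc hd, ?_⟩
    simp only [Matrix.mulVec_add]
    exact (h.trans (exp_mono (min_le_left _ _))).add (h'.trans (exp_mono (min_le_right _ _)))
  zero_mem' := ⟨1, one_pos, by simp only [Matrix.mulVec_zero]; exact isBigO_zero _ _⟩
  smul_mem' := by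
    rintro a v ⟨c, hc, h⟩
    refine ⟨c, hc, ?_⟩
    simp only [Matrix.mulVec_smul]
    exact h.const_smul_left a

lemma decay_top {p : ℕ} (M : Matrix (Fin p) (Fin p) ℂ) (hM : ∀ μ ∈ spectrum ℂ M, 0 < μ.re) :
    decaySub M = ⊤ := by
  rw [eq_top_iff, ← Module.End.iSup_maxGenEigenspace_eq_top (Matrix.toLin' M)]
  refine iSup_le fun μ v hv => ?_
  rw [Module.End.mem_maxGenEigenspace] at hv
  obtain ⟨k, hk⟩ := hv
  have hk' : ((M - μ • 1) ^ k) *ᵥ v = 0 := by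
    rw [← Matrix.toLin'_apply, Matrix.toLin'_pow]
    simpa [Matrix.toLin'_one, Module.End.one_eq_id] using hk
  by_cases hμ : μ ∈ spectrum ℂ M
  · have hpos := hM μ hμ
    refine ⟨μ.re / 2, by linarith, ?_⟩
    have e : ∀ s : ℝ, NormedSpace.exp ((-s : ℂ) • M) *ᵥ v =
        ∑ j ∈ Finset.range k, (Complex.exp (-s * μ) * ((j.factorial : ℂ)⁻¹ * (-s : ℂ) ^ j)) •
          (((M - μ • 1) ^ j) *ᵥ v) := by
      intro s
      rw [exp_shift M μ, Matrix.smul_mulVec, exp_nil_vec _ v k hk', Finset.smul_sum]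
      simp only [smul_smul]
    simp only [e]
    refine IsBigO.fun_sum fun j _ => ?_
    have hb : (fun s : ℝ => Complex.exp (-s * μ) * ((j.factorial : ℂ)⁻¹ * (-s : ℂ) ^ j))
        =O[atTop] fun s : ℝ => Real.exp (-(μ.re / 2) * s) := by
      have h1 : (fun s : ℝ => Complex.exp (-s * μ)) =O[atTop] fun s : ℝ => Real.exp (-μ.re * s) := by
        refine IsBigO.of_bound 1 (Eventually.of_forall fun s => ?_)
        simp [Complex.norm_exp, mul_comm]
      have h2 : (fun s : ℝ => (j.factorial : ℂ)⁻¹ * (-s : ℂ) ^ j) =O[atTop]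
          fun s : ℝ => Real.exp (μ.re / 2 * s) := by
        refine IsBigO.const_mul_left ?_ _
        refine IsBigO.trans ?_ (isLittleO_pow_exp_pos_mul_atTop j (half_pos hpos)).isBigO
        refine IsBigO.of_bound 1 (Eventually.of_forall fun s => ?_)
        simp
      refine (h1.mul h2).congr_right fun s => ?_
      rw [← Real.exp_add]; congr 1; ring
    have hc : (fun _ : ℝ => ((M - μ • 1) ^ j) *ᵥ v) =O[atTop] fun _ : ℝ => (1 : ℝ) :=
      isBigO_const_const _ one_ne_zero _
    simpa using hb.smul hc
  · have hu : IsUnit (M - μ • 1) := by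
      rw [spectrum.notMem_iff, Algebra.algebraMap_eq_smul_one] at hμ
      simpa using hμ.neg
    have hv0 : v = 0 := by
      obtain ⟨u, hu'⟩ := hu.pow k
      have : (↑u⁻¹ : Matrix (Fin p) (Fin p) ℂ) *ᵥ (((M - μ • 1) ^ k) *ᵥ v) = v := by
        rw [Matrix.mulVec_mulVec, ← hu', Units.inv_mul, Matrix.one_mulVec]
      rw [← this, hk', Matrix.mulVec_zero]
    rw [hv0]; exact Submodule.zero_mem _

lemma map_exp_real {p : ℕ} (X : Matrix (Fin p) (Fin p) ℝ) :
    (NormedSpace.exp X).map Complex.ofReal = NormedSpace.exp (X.map Complex.ofReal) := by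
  have hc : Continuous (Complex.ofRealHom.mapMatrix :
      Matrix (Fin p) (Fin p) ℝ →+* Matrix (Fin p) (Fin p) ℂ) :=
    Continuous.matrix_map continuous_id Complex.continuous_ofReal
  exact NormedSpace.map_exp (Complex.ofRealHom.mapMatrix) hc X

lemma entry_decay {p : ℕ} (A : Matrix (Fin p) (Fin p) ℝ) (hA : EigPos A) (i j : Fin p) :
    ∃ c : ℝ, 0 < c ∧ (fun s : ℝ => NormedSpace.exp (s • (-A)) i j) =O[atTop]
      fun s : ℝ => Real.exp (-c * s) := by
  have h : Pi.single j 1 ∈ decaySub (A.map Complex.ofReal) := by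
    rw [decay_top _ hA]; trivial
  obtain ⟨c, hc, h⟩ := h
  refine ⟨c, hc, ?_⟩
  have h' := isBigO_pi.1 h i
  refine IsBigO.trans (IsBigO.of_bound 1 (Eventually.of_forall fun s => ?_)) h'
  have e : ((-s : ℂ) • A.map Complex.ofReal) = (s • (-A)).map Complex.ofReal := by
    ext a b; simp
  rw [e, ← map_exp_real, Matrix.mulVec_single_one]
  simp

lemma unif_decay {p : ℕ} (A : Matrix (Fin p) (Fin p) ℝ) (hA : EigPos A) :
    ∃ c : ℝ, 0 < c ∧ ∀ i j, (fun s : ℝ => NormedSpace.exp (s • (-A)) i j) =O[atTop]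
      fun s : ℝ => Real.exp (-c * s) := by
  choose c hc h using entry_decay A hA
  obtain ⟨m, hm, hle⟩ : ∃ m : ℝ, 0 < m ∧ ∀ q : Fin p × Fin p, m ≤ c q.1 q.2 := by
    have hf : (Set.range fun q : Fin p × Fin p => c q.1 q.2).Finite := Set.finite_range _
    rcases isEmpty_or_nonempty (Fin p × Fin p) with h0 | h0
    · exact ⟨1, one_pos, fun q => h0.elim q⟩
    · obtain ⟨q, hq⟩ := Finite.exists_min fun q : Fin p × Fin p => c q.1 q.2
      exact ⟨_, hc q.1 q.2, hq⟩
  exact ⟨m, hm, fun i j => (h i j).trans (exp_mono (hle (i, j)))⟩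

noncomputable def FF {p : ℕ} (A X : Matrix (Fin p) (Fin p) ℝ) (s : ℝ) : Matrix (Fin p) (Fin p) ℝ :=
  NormedSpace.exp (s • (-A)) * X * NormedSpace.exp (s • (-A))

lemma FF_decay {p : ℕ} (A : Matrix (Fin p) (Fin p) ℝ) (hA : EigPos A) :
    ∃ c : ℝ, 0 < c ∧ ∀ X i j, (fun s : ℝ => FF A X s i j) =O[atTop]
      fun s : ℝ => Real.exp (-c * s) := by
  obtain ⟨c, hc, h⟩ := unif_decay A hA
  refine ⟨c + c, by linarith, fun X i j => ?_⟩
  simp only [FF, Matrix.mul_apply, Finset.sum_mul]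
  refine IsBigO.fun_sum fun a _ => IsBigO.fun_sum fun b _ => ?_
  have h1 := ((h i b).mul (h a j)).const_mul_left (X b a)
  refine h1.congr (fun s => by ring) fun s => ?_
  rw [← Real.exp_add]; congr 1; ring

lemma FF_deriv {p : ℕ} (A X : Matrix (Fin p) (Fin p) ℝ) (s : ℝ) :
    HasDerivAt (FF A X) (FF A (-(A * X + X * A)) s) s := by
  have h1 := hasDerivAt_exp_smul_const (-A) s
  have h2 := hasDerivAt_exp_smul_const' (-A) s
  have h3 := (h1.mul_const X).mul h2
  refine h3.congr_deriv ?_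
  simp only [FF]
  noncomm_ring

lemma FF_deriv_entry {p : ℕ} (A X : Matrix (Fin p) (Fin p) ℝ) (s : ℝ) (i j : Fin p) :
    HasDerivAt (fun s => FF A X s i j) (FF A (-(A * X + X * A)) s i j) s := by
  let L : Matrix (Fin p) (Fin p) ℝ →ₗ[ℝ] ℝ := Matrix.entryLinearMap ℝ ℝ i j
  have hL : Continuous L := L.continuous_of_finiteDimensional
  exact (ContinuousLinearMap.hasFDerivAt (⟨L, hL⟩ : Matrix (Fin p) (Fin p) ℝ →L[ℝ] ℝ)).comp_hasDerivAt
    s (FF_deriv A X s)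

lemma FF_int {p : ℕ} (A : Matrix (Fin p) (Fin p) ℝ) (hA : EigPos A) (X) (i j : Fin p) :
    IntegrableOn (fun s => FF A X s i j) (Set.Ioi 0) := by
  obtain ⟨c, hc, h⟩ := FF_decay A hA
  exact integrable_of_isBigO_exp_neg hc
    (fun s _ => (FF_deriv_entry A X s i j).continuousAt.continuousWithinAt) (h X i j)

lemma FF_integral {p : ℕ} (A : Matrix (Fin p) (Fin p) ℝ) (hA : EigPos A) (X) (i j : Fin p) :
    ∫ s in Set.Ioi (0 : ℝ), FF A (A * X + X * A) s i j = X i j := by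
  obtain ⟨c, hc, h⟩ := FF_decay A hA
  have ht : Tendsto (fun s => FF A X s i j) atTop (𝓝 0) := by
    refine (h X i j).trans_tendsto ?_
    refine Real.tendsto_exp_atBot.comp ?_
    exact tendsto_id.const_mul_atTop_of_neg (by linarith)
  have := integral_Ioi_of_hasDerivAt_of_tendsto' (a := 0)
    (fun s _ => FF_deriv_entry A X s i j) (FF_int A hA _ i j) ht
  have e : ∀ s, FF A (-(A * X + X * A)) s i j = - FF A (A * X + X * A) s i j := by
    intro s; simp only [FF, mul_neg, neg_mul, Matrix.neg_apply]
  simp only [e, integral_neg] at this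
  have h0 : FF A X 0 = X := by simp [FF]
  rw [h0] at this
  linarith

lemma Pmat_apply {p : ℕ} (A : Matrix (Fin p) (Fin p) ℝ) (B : Matrix (Fin p) (Fin 1) ℝ)
    (C : Matrix (Fin 1) (Fin p) ℝ) (i j : Fin p) :
    Pmat A B C i j = ∫ s in Set.Ioi (0 : ℝ), FF A (B * C) s i j := by
  simp only [Pmat, Matrix.of_apply, FF, mexp_eq, smul_neg]

lemma FF_comm {p : ℕ} (A X : Matrix (Fin p) (Fin p) ℝ) (s : ℝ) :
    FF A (A * X + X * A) s = A * FF A X s + FF A X s * A := by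
  have hc : Commute A (NormedSpace.exp (s • (-A))) :=
    (((Commute.refl A).neg_right).smul_right s).exp_right
  have := hc.eq
  simp only [FF, mul_add, add_mul]
  congr 1
  · rw [← mul_assoc, ← this]; simp only [mul_assoc]
  · simp only [mul_assoc]; rw [this]

theorem statement15 {p : ℕ} (hp : 0 < p) (A : Matrix (Fin p) (Fin p) ℝ) (hA : EigPos A) :
    ∀ (B : Matrix (Fin p) (Fin 1) ℝ) (C : Matrix (Fin 1) (Fin p) ℝ),
      (A * Pmat A B C + Pmat A B C * A = B * C) ∧
      (∀ P' : Matrix (Fin p) (Fin p) ℝ, A * P' + P' * A = B * C → P' = Pmat A B C) := by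
  intro B C
  refine ⟨?_, fun P' h => ?_⟩
  · ext i j
    rw [← FF_integral A hA (B * C) i j]
    simp only [FF_comm, Matrix.add_apply, Matrix.mul_apply (M := A), Matrix.mul_apply (N := A), Pmat_apply]
    have i1 : ∀ k, Integrable (fun s => A i k * FF A (B * C) s k j)
      (volume.restrict (Set.Ioi 0)) := fun k => (FF_int A hA _ k j).const_mul _
    have i2 : ∀ k, Integrable (fun s => FF A (B * C) s i k * A k j)
      (volume.restrict (Set.Ioi 0)) := fun k => (FF_int A hA _ i k).mul_const _
    rw [integral_add (integrable_finsetSum _ fun k _ => i1 k)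
      (integrable_finsetSum _ fun k _ => i2 k), integral_finsetSum _ fun k _ => i1 k,
      integral_finsetSum _ fun k _ => i2 k]
    simp only [integral_const_mul, integral_mul_const]
  · ext i j
    rw [Pmat_apply, ← h, FF_integral A hA]
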